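/- arXiv:1803.05542 — 2 statements merged into one kernel-verified Lean document; each statement's English description precedes it below -/
import Mathlib

section
/- If the attacker's action space is A_a = [1/C_d, λ_max] with λ_max > 1/C_d, then for any T > 0 and any τ_min with 0 < τ_min < T the game admits a pure-strategy Nash equilibrium: there exists (τ*, λ*) ∈ [τ_min, T] × [1/C_d, λ_max] such that u_d(τ*, λ*) ≥ u_d(τ, λ*) for all τ ∈ [τ_min, T] and u_a(τ*, λ*) ≥ u_a(τ*, λ) for all λ ∈ [1/C_d, λ_max]. -/
open MeasureTheory Set Real

/-- Attacker payoff in the specific instantiation `G(τ_d,τ_a) = τ_d − τ_a`,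
`f(τ_a; λ) = λ e^{−λ τ_a}`: `u_a(τ_d, λ) = τ_d − ∫₀^{τ_d} e^{−λ s} ds − λ C_a`. -/
noncomputable def uaExp (Ca τd l : ℝ) : ℝ :=
  τd - (∫ s in (0:ℝ)..τd, Real.exp (-l * s)) - l * Ca

/-- Defender payoff in the specific instantiation:
`u_d(τ_d, λ) = −(τ_d − ∫₀^{τ_d} e^{−λ s} ds + C_d)/τ_d`. -/
noncomputable def udExp (Cd τd l : ℝ) : ℝ :=
  -(τd - (∫ s in (0:ℝ)..τd, Real.exp (-l * s)) + Cd) / τd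

theorem integral_exp_neg_mul {l : ℝ} (hl : l ≠ 0) (t : ℝ) :
    ∫ s in (0:ℝ)..t, Real.exp (-l * s) = (1 - Real.exp (-l * t)) / l := by
  rw [intervalIntegral.integral_comp_mul_left (fun x => Real.exp x) (neg_ne_zero.mpr hl),
    integral_exp]
  simp only [mul_zero, Real.exp_zero, smul_eq_mul]
  field_simp
  ring

theorem udExp_eq {l t : ℝ} (hl : l ≠ 0) (ht : t ≠ 0) (Cd : ℝ) :
    udExp Cd t l = -(1 + (Cd - 1 / l + Real.exp (-l * t) / l) / t) := by
  rw [udExp, integral_exp_neg_mul hl]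
  field_simp
  ring

/-- For attack rates at least `1 / Cd`, the defender payoff increases with the migration time. -/
theorem monotoneOn_udExp {Cd l : ℝ} (hCd : 0 < Cd) (hl : 1 / Cd ≤ l) :
    MonotoneOn (fun t => udExp Cd t l) (Ioi 0) := by
  intro s hs t ht hst
  have hs' : 0 < s := hs
  have ht' : 0 < t := ht
  have hl0 : 0 < l := (one_div_pos.mpr hCd).trans_le hl
  have hCl : 0 ≤ Cd - 1 / l := sub_nonneg.mpr ((one_div_le hCd hl0).mp hl)
  simp only
  rw [udExp_eq hl0.ne' hs'.ne', udExp_eq hl0.ne' ht'.ne']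
  have hexp : Real.exp (-l * t) ≤ Real.exp (-l * s) :=
    Real.exp_le_exp.mpr (mul_le_mul_of_nonpos_left hst (neg_nonpos.mpr hl0.le))
  gcongr

theorem continuous_uaExp (Ca t : ℝ) : Continuous (uaExp Ca t) := by
  have h : Continuous fun l : ℝ => ∫ s in (0:ℝ)..t, Real.exp (-l * s) :=
    intervalIntegral.continuous_parametric_intervalIntegral_of_continuous' (by fun_prop) 0 t
  unfold uaExp
  fun_prop

/-- Corollary 1: with attacker action space `[1/C_d, λ_max]`, `λ_max > 1/C_d`, the game
admits a pure-strategy Nash equilibrium for any `T > 0` and `0 < τ_min < T`. -/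
theorem nash_existence_corollary_one
    (τmin T lmax Ca Cd : ℝ)
    (hT : 0 < T) (hτmin : 0 < τmin) (hτT : τmin < T)
    (hCa : 0 < Ca) (hCd : 0 < Cd)
    (hlmax : 1 / Cd < lmax) :
    ∃ τstar ∈ Icc τmin T, ∃ lstar ∈ Icc (1 / Cd) lmax,
      (∀ τ ∈ Icc τmin T, udExp Cd τ lstar ≤ udExp Cd τstar lstar) ∧
      (∀ l ∈ Icc (1 / Cd) lmax, uaExp Ca τstar l ≤ uaExp Ca τstar lstar) := by
  obtain ⟨l, hl, hmax⟩ := isCompact_Icc.exists_isMaxOn (nonempty_Icc.mpr hlmax.le)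
    (continuous_uaExp Ca T).continuousOn
  exact ⟨T, right_mem_Icc.mpr hτT.le, l, hl,
    fun τ hτ => monotoneOn_udExp hCd hl.1 (hτmin.trans_le hτ.1) hT hτ.2,
    fun _ h => hmax h⟩
end

section
/- If T ≤ 5 C_d, then for any τ_min with 0 < τ_min ≤ T and any 0 ≤ λ_min ≤ λ_max the game admits a pure-strategy Nash equilibrium: there exists (τ*, λ*) ∈ [τ_min, T] × [λ_min, λ_max] such that u_d(τ*, λ*) ≥ u_d(τ, λ*) for all τ ∈ [τ_min, T] and u_a(τ*, λ*) ≥ u_a(τ*, λ) for all λ ∈ [λ_min, λ_max]. -/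
open MeasureTheory Set Real

theorem continuous_integral_exp_neg_mul :
    Continuous fun p : ℝ × ℝ => ∫ s in (0 : ℝ)..p.1, Real.exp (-p.2 * s) :=
  intervalIntegral.continuous_parametric_intervalIntegral_of_continuous (by fun_prop)
    continuous_fst

theorem intervalIntegrable_exp_neg_mul (l a b : ℝ) :
    IntervalIntegrable (fun s => Real.exp (-l * s)) volume a b :=
  Continuous.intervalIntegrable (by fun_prop) a b

/-- The tangent line inequality for the concave function `τ ↦ ∫₀^τ e^{-l s} ds`. -/
theorem integral_exp_neg_mul_le_tangent {l : ℝ} (hl : 0 ≤ l) (t τ : ℝ) :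
    ∫ s in (0 : ℝ)..τ, Real.exp (-l * s) ≤
      (∫ s in (0 : ℝ)..t, Real.exp (-l * s)) + Real.exp (-l * t) * (τ - t) := by
  have hadd := intervalIntegral.integral_add_adjacent_intervals
    (intervalIntegrable_exp_neg_mul l 0 t) (intervalIntegrable_exp_neg_mul l t τ)
  have hconst (a b : ℝ) : ∫ _ in a..b, Real.exp (-l * t) = Real.exp (-l * t) * (b - a) := by
    rw [intervalIntegral.integral_const, smul_eq_mul, mul_comm]
  rcases le_total t τ with h | h
  · have hle := intervalIntegral.integral_mono_on h (intervalIntegrable_exp_neg_mul l t τ)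
      intervalIntegrable_const (g := fun _ => Real.exp (-l * t))
      fun s hs => Real.exp_le_exp.2 (by nlinarith [hs.1])
    rw [hconst] at hle
    linarith
  · have hle := intervalIntegral.integral_mono_on h intervalIntegrable_const
      (intervalIntegrable_exp_neg_mul l τ t) (f := fun _ => Real.exp (-l * t))
      fun s hs => Real.exp_le_exp.2 (by nlinarith [hs.2])
    rw [hconst] at hle
    rw [intervalIntegral.integral_symm τ t] at hadd
    linarith

theorem convexOn_integral_exp_neg_mul {τ : ℝ} (hτ : 0 ≤ τ) :
    ConvexOn ℝ univ fun l : ℝ => ∫ s in (0 : ℝ)..τ, Real.exp (-l * s) := by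
  refine ⟨convex_univ, fun x _ y _ a b ha hb hab => ?_⟩
  have hx := intervalIntegrable_exp_neg_mul x 0 τ
  have hy := intervalIntegrable_exp_neg_mul y 0 τ
  simp only [smul_eq_mul]
  rw [← intervalIntegral.integral_const_mul, ← intervalIntegral.integral_const_mul,
    ← intervalIntegral.integral_add (hx.const_mul a) (hy.const_mul b)]
  refine intervalIntegral.integral_mono_on hτ (intervalIntegrable_exp_neg_mul _ 0 τ)
    ((hx.const_mul a).add (hy.const_mul b)) fun s _ => ?_
  have h := convexOn_exp.2 (mem_univ (-x * s)) (mem_univ (-y * s)) ha hb hab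
  simp only [smul_eq_mul] at h
  have hexp : -(a * x + b * y) * s = a * (-x * s) + b * (-y * s) := by ring
  rwa [hexp]

theorem continuous_uaExp_s11 (Ca : ℝ) : Continuous fun p : ℝ × ℝ => uaExp Ca p.1 p.2 :=
  (continuous_fst.sub continuous_integral_exp_neg_mul).sub (continuous_snd.mul continuous_const)

theorem concaveOn_uaExp (Ca : ℝ) {τ : ℝ} (hτ : 0 ≤ τ) : ConcaveOn ℝ univ (uaExp Ca τ) := by
  refine ⟨convex_univ, fun x hx y hy a b ha hb hab => ?_⟩
  have h := (convexOn_integral_exp_neg_mul hτ).2 hx hy ha hb hab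
  simp only [smul_eq_mul, uaExp] at h ⊢
  linear_combination h + τ * hab

/-- The numerator of the derivative of `τ ↦ udExp Cd τ l`, which is this quantity over `τ ^ 2`. -/
noncomputable def udExpSlope (Cd τ l : ℝ) : ℝ :=
  τ * Real.exp (-l * τ) - (∫ s in (0 : ℝ)..τ, Real.exp (-l * s)) + Cd

theorem continuous_udExpSlope (Cd : ℝ) : Continuous fun p : ℝ × ℝ => udExpSlope Cd p.1 p.2 :=
  ((by fun_prop : Continuous fun p : ℝ × ℝ => p.1 * Real.exp (-p.2 * p.1)).sub
    continuous_integral_exp_neg_mul).add continuous_const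

theorem udExp_le_of_slope {Cd l t τ : ℝ} (hl : 0 ≤ l) (ht : 0 < t) (hτ : 0 < τ)
    (h : udExpSlope Cd t l * (τ - t) ≤ 0) : udExp Cd τ l ≤ udExp Cd t l := by
  have htan := mul_le_mul_of_nonneg_left (integral_exp_neg_mul_le_tangent hl t τ) ht.le
  unfold udExpSlope at h
  unfold udExp
  rw [div_le_div_iff₀ hτ ht]
  linear_combination htan + h

/-- Rates `l ∈ [a, b]` that maximize the attacker's payoff against `τ`. -/
def attackerBestResponse (Ca a b τ : ℝ) : Set ℝ :=
  {l ∈ Icc a b | ∀ m ∈ Icc a b, uaExp Ca τ m ≤ uaExp Ca τ l}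

theorem attackerBestResponse_nonempty (Ca τ : ℝ) {a b : ℝ} (hab : a ≤ b) :
    (attackerBestResponse Ca a b τ).Nonempty := by
  obtain ⟨l, hl, hmax⟩ := isCompact_Icc.exists_isMaxOn (nonempty_Icc.2 hab)
    ((continuous_uaExp_s11 Ca).comp (by fun_prop : Continuous fun l : ℝ => (τ, l))).continuousOn
  exact ⟨l, hl, fun m hm => hmax hm⟩

theorem convex_attackerBestResponse (Ca a b : ℝ) {τ : ℝ} (hτ : 0 ≤ τ) :
    Convex ℝ (attackerBestResponse Ca a b τ) := by
  have hconc := (concaveOn_uaExp Ca hτ).subset (subset_univ _) (convex_Icc a b)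
  intro x hx y hy
  have hconv := hconc.convex_ge (uaExp Ca τ x)
  intro p q hp hq hpq
  have h := hconv ⟨hx.1, le_rfl⟩ ⟨hy.1, hy.2 x hx.1⟩ hp hq hpq
  exact ⟨h.1, fun m hm => (hx.2 m hm).trans h.2⟩

theorem isCompact_graph_attackerBestResponse (Ca a b c d : ℝ) :
    IsCompact {p : ℝ × ℝ | p.1 ∈ Icc c d ∧ p.2 ∈ attackerBestResponse Ca a b p.1} := by
  have hclosed : IsClosed {p : ℝ × ℝ | ∀ m ∈ Icc a b, uaExp Ca p.1 m ≤ uaExp Ca p.1 p.2} := by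
    simp only [ofPred_forall]
    exact isClosed_iInter fun m => isClosed_iInter fun _ => isClosed_le
      ((continuous_uaExp_s11 Ca).comp (by fun_prop : Continuous fun p : ℝ × ℝ => (p.1, m)))
      (continuous_uaExp_s11 Ca)
  convert ((isCompact_Icc (a := c) (b := d)).prod (isCompact_Icc (a := a) (b := b))).inter_right
    hclosed using 1
  ext p
  simp only [attackerBestResponse, mem_ofPred_eq, mem_inter_iff, mem_prod, and_assoc]

/-- If the slope is positive along best responses at `c` and negative along them at `d`, then it
vanishes along a best response in between. -/
theorem exists_slope_eq_zero {Ca Cd a b c d : ℝ} (hab : a ≤ b) (hc : 0 ≤ c) (hcd : c ≤ d)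
    (hleft : ∀ l ∈ attackerBestResponse Ca a b c, 0 < udExpSlope Cd c l)
    (hright : ∀ l ∈ attackerBestResponse Ca a b d, udExpSlope Cd d l < 0) :
    ∃ τ ∈ Icc c d, ∃ l ∈ attackerBestResponse Ca a b τ, udExpSlope Cd τ l = 0 := by
  have hgraph := isCompact_graph_attackerBestResponse Ca a b c d
  have hpos := ((hgraph.inter_right
    (isClosed_le continuous_const (continuous_udExpSlope Cd) (f := fun _ => 0))).image
      continuous_fst).isClosed
  have hneg := ((hgraph.inter_right
    (isClosed_le (continuous_udExpSlope Cd) continuous_const (g := fun _ => 0))).image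
      continuous_fst).isClosed
  obtain ⟨lc, hlc⟩ := attackerBestResponse_nonempty Ca c hab
  obtain ⟨ld, hld⟩ := attackerBestResponse_nonempty Ca d hab
  have hcmem := left_mem_Icc.2 hcd
  have hdmem := right_mem_Icc.2 hcd
  obtain ⟨τ, hτ, ⟨⟨_, l₁⟩, ⟨⟨_, hl₁⟩, hs₁⟩, rfl⟩, ⟨⟨τ, l₂⟩, ⟨⟨_, hl₂⟩, hs₂⟩, rfl⟩⟩ :=
    isPreconnected_closed_iff.1 (isPreconnected_Icc (a := c) (b := d)) _ _ hpos hneg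
      (fun τ hτ => by
        obtain ⟨l, hl⟩ := attackerBestResponse_nonempty Ca τ hab
        exact (le_total 0 (udExpSlope Cd τ l)).imp (fun h => ⟨(τ, l), ⟨⟨hτ, hl⟩, h⟩, rfl⟩)
          fun h => ⟨(τ, l), ⟨⟨hτ, hl⟩, h⟩, rfl⟩)
      ⟨c, hcmem, (c, lc), ⟨⟨hcmem, hlc⟩, (hleft lc hlc).le⟩, rfl⟩
      ⟨d, hdmem, (d, ld), ⟨⟨hdmem, hld⟩, (hright ld hld).le⟩, rfl⟩
  have hcont : Continuous (udExpSlope Cd τ) :=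
    (continuous_udExpSlope Cd).comp (by fun_prop : Continuous fun l : ℝ => (τ, l))
  obtain ⟨l, hl, hzero⟩ :=
    (convex_attackerBestResponse Ca a b (hc.trans hτ.1)).isPreconnected.intermediate_value
      hl₂ hl₁ hcont.continuousOn ⟨hs₂, hs₁⟩
  exact ⟨τ, hτ, l, hl, hzero⟩

/-- Corollary 2: if `T ≤ 5 C_d`, the game admits a pure-strategy Nash equilibrium for any
`0 < τ_min ≤ T` and `0 ≤ λ_min ≤ λ_max`. -/
theorem nash_existence_corollary_two
    (τmin T lmin lmax Ca Cd : ℝ)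
    (hτmin : 0 < τmin) (hτT : τmin ≤ T)
    (hlmin : 0 ≤ lmin) (hl : lmin ≤ lmax)
    (hCa : 0 < Ca) (hCd : 0 < Cd)
    (hT : T ≤ 5 * Cd) :
    ∃ τstar ∈ Icc τmin T, ∃ lstar ∈ Icc lmin lmax,
      (∀ τ ∈ Icc τmin T, udExp Cd τ lstar ≤ udExp Cd τstar lstar) ∧
      (∀ l ∈ Icc lmin lmax, uaExp Ca τstar l ≤ uaExp Ca τstar lstar) := by
  have key : ∃ t ∈ Icc τmin T, ∃ l ∈ attackerBestResponse Ca lmin lmax t,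
      ∀ τ ∈ Icc τmin T, udExpSlope Cd t l * (τ - t) ≤ 0 := by
    by_cases hleft : ∀ l ∈ attackerBestResponse Ca lmin lmax τmin, 0 < udExpSlope Cd τmin l
    · by_cases hright : ∀ l ∈ attackerBestResponse Ca lmin lmax T, udExpSlope Cd T l < 0
      · obtain ⟨t, ht, l, hl, hzero⟩ := exists_slope_eq_zero hl hτmin.le hτT hleft hright
        exact ⟨t, ht, l, hl, fun τ _ => by simp [hzero]⟩
      · push Not at hright
        obtain ⟨l, hl, hs⟩ := hright
        exact ⟨T, right_mem_Icc.2 hτT, l, hl, fun τ hτ =>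
          mul_nonpos_of_nonneg_of_nonpos hs (sub_nonpos.2 hτ.2)⟩
    · push Not at hleft
      obtain ⟨l, hl, hs⟩ := hleft
      exact ⟨τmin, left_mem_Icc.2 hτT, l, hl, fun τ hτ =>
        mul_nonpos_of_nonpos_of_nonneg hs (sub_nonneg.2 hτ.1)⟩
  obtain ⟨t, ht, l, ⟨hlmem, hlmax⟩, hs⟩ := key
  exact ⟨t, ht, l, hlmem, fun τ hτ => udExp_le_of_slope (hlmin.trans hlmem.1)
    (hτmin.trans_le ht.1) (hτmin.trans_le hτ.1) (hs τ hτ), hlmax⟩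
end
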